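/- Let n be a positive even integer and let p > n + 1 be a prime. For r ∈ {0, 1, 2, 3, 4, 5} let S_r denote the sum in ℤ/pℤ of 1/(i_1 ⋯ i_n) over all n-tuples of integers 0 < i_1 < i_2 < ⋯ < i_n < p with i_1 ≡ r (mod 6). Then 2·S_0 + S_1 - S_2 - 2·S_3 - S_4 + S_5 = 0 in ℤ/pℤ. -/

import Mathlib

/-- `S_r` is the sum in `ℤ/pℤ` of `1/(i₁⋯iₙ)` over all strictly increasing `n`-tuples of
integers `0 < i₁ < ⋯ < iₙ < p` with `i₁ ≡ r (mod 6)`. -/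
noncomputable def zhaoSunS (n p : ℕ) (hn : 0 < n) (r : ℕ) : ZMod p :=
  ∑ f ∈ (Fintype.piFinset fun _ : Fin n => Finset.Ioo 0 p).filter
      (fun f => (∀ i j : Fin n, i < j → f i < f j) ∧ f ⟨0, hn⟩ % 6 = r),
    ∏ k : Fin n, ((f k : ZMod p))⁻¹

open Polynomial in
/-- A polynomial of degree less than the characteristic whose derivative and constant term vanish
is zero. -/
theorem Polynomial.eq_zero_of_derivative_eq_zero_of_natDegree_lt {p : ℕ} [Fact p.Prime]
    {f : (ZMod p)[X]} (hdeg : f.natDegree < p) (hder : derivative f = 0) (h0 : f.eval 0 = 0) :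
    f = 0 := by
  ext i
  rcases i with _ | i
  · simpa [coeff_zero_eq_eval_zero] using h0
  · rcases lt_or_ge (i + 1) p with hi | hi
    · have h := coeff_derivative f i
      rw [hder, coeff_zero, eq_comm, mul_eq_zero] at h
      refine h.resolve_right fun h' => ?_
      have h'' : ((i + 1 : ℕ) : ZMod p) = 0 := by exact_mod_cast h'
      rw [ZMod.natCast_eq_zero_iff] at h''
      exact absurd (Nat.le_of_dvd (Nat.succ_pos i) h'') (by omega)
    · exact coeff_eq_zero_of_natDegree_lt (by omega)

open Polynomial in
/-- A polynomial `f` of degree less than the characteristic that vanishes at `0` and `1` satisfies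
`f(1 - x) = s f(x)` as soon as `x(x - 1)f'(x)` changes by the factor `-s` under `x ↦ 1 - x`. -/
theorem Polynomial.comp_one_sub_X_of_derivative {p : ℕ} [Fact p.Prime] {f E : (ZMod p)[X]}
    {s : ZMod p} (hdeg : f.natDegree < p) (h0 : f.eval 0 = 0) (h1 : f.eval 1 = 0)
    (hE : X * (X - 1) * derivative f = E) (hs : E.comp (1 - X) = -C s * E) :
    f.comp (1 - X) = C s * f := by
  rw [← sub_eq_zero]
  apply eq_zero_of_derivative_eq_zero_of_natDegree_lt
  · refine lt_of_le_of_lt (natDegree_sub_le _ _) (max_lt ?_ ?_)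
    · refine lt_of_le_of_lt natDegree_comp_le (lt_of_le_of_lt ?_ hdeg)
      have : (1 - X : (ZMod p)[X]).natDegree ≤ 1 := by compute_degree
      nlinarith
    · exact lt_of_le_of_lt (natDegree_C_mul_le _ _) hdeg
  · have hX : (X * (X - 1) : (ZMod p)[X]) ≠ 0 :=
      mul_ne_zero X_ne_zero (by simpa using X_sub_C_ne_zero (1 : ZMod p))
    refine (mul_eq_zero.1 ?_).resolve_left hX
    rw [← hE] at hs
    simp only [mul_comp, sub_comp, X_comp, one_comp] at hs
    simp only [derivative_sub, derivative_comp, derivative_C_mul, derivative_one, derivative_X]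
    linear_combination -hs
  · simp [h0, h1]

/-- The sum of `1/(i₁⋯iₘ)` over `k < i₁ < ⋯ < iₘ < p`. -/
noncomputable def nestedHarmonicSum (p : ℕ) : ℕ → ℕ → ZMod p
  | 0, _ => 1
  | m + 1, k => ∑ i ∈ Finset.Ioo k p, (i : ZMod p)⁻¹ * nestedHarmonicSum p m i

theorem sum_increasing_tuples_succ (p m k : ℕ) (w : ℕ → ZMod p) :
    ∑ f ∈ (Fintype.piFinset fun _ : Fin (m + 1) => Finset.Ioo k p).filter
        (fun f => ∀ i j, i < j → f i < f j), w (f 0) * ∏ a, ((f a : ZMod p))⁻¹ =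
      ∑ i ∈ Finset.Ioo k p, w i * ((i : ZMod p)⁻¹ *
        ∑ f ∈ (Fintype.piFinset fun _ : Fin m => Finset.Ioo i p).filter
          (fun f => ∀ i j, i < j → f i < f j), ∏ a, ((f a : ZMod p))⁻¹) := by
  simp only [Finset.mul_sum]
  rw [Finset.sum_sigma']
  refine Finset.sum_bij' (fun f _ => ⟨f 0, Fin.tail f⟩) (fun x _ => Fin.cons x.1 x.2) ?_ ?_ ?_ ?_ ?_
  · intro f hf
    simp only [Finset.mem_filter, Fintype.mem_piFinset, Finset.mem_Ioo, Finset.mem_sigma,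
      Fin.tail] at hf ⊢
    exact ⟨hf.1 0, fun a => ⟨hf.2 _ _ (Fin.succ_pos a), (hf.1 _).2⟩,
      fun i j hij => hf.2 _ _ (Fin.succ_lt_succ_iff.2 hij)⟩
  · rintro ⟨i, f⟩ hf
    simp only [Finset.mem_filter, Fintype.mem_piFinset, Finset.mem_Ioo, Finset.mem_sigma] at hf ⊢
    obtain ⟨hi, hf, hmono⟩ := hf
    constructor
    · intro a
      cases a using Fin.cases with
      | zero => simpa using hi
      | succ a => simpa using ⟨hi.1.trans (hf a).1, (hf a).2⟩
    · intro a b hab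
      cases b using Fin.cases with
      | zero => exact absurd hab (Fin.not_lt_zero a)
      | succ b =>
        cases a using Fin.cases with
        | zero => simpa using (hf b).1
        | succ a => simpa using hmono a b (Fin.succ_lt_succ_iff.1 hab)
  · intro f _
    exact Fin.cons_self_tail f
  · rintro ⟨i, f⟩ _
    simp
  · intro f _
    rw [Fin.prod_univ_succ]
    rfl

theorem sum_increasing_tuples (p m k : ℕ) :
    ∑ f ∈ (Fintype.piFinset fun _ : Fin m => Finset.Ioo k p).filter
        (fun f => ∀ i j, i < j → f i < f j), ∏ a, ((f a : ZMod p))⁻¹ =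
      nestedHarmonicSum p m k := by
  induction m generalizing k with
  | zero => simp [nestedHarmonicSum]
  | succ m ih =>
    have h := sum_increasing_tuples_succ p m k fun _ => 1
    simp only [one_mul, ih] at h
    exact h

theorem zhaoSunS_eq_sum (p m r : ℕ) (hm : 0 < m + 1) :
    zhaoSunS (m + 1) p hm r = ∑ i ∈ Finset.Ioo 0 p,
      (if i % 6 = r then 1 else 0) * ((i : ZMod p)⁻¹ * nestedHarmonicSum p m i) := by
  have h := sum_increasing_tuples_succ p m 0 fun i => if i % 6 = r then 1 else 0
  simp only [sum_increasing_tuples] at h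
  rw [← h, zhaoSunS, ← Finset.filter_filter, Finset.sum_filter]
  refine Finset.sum_congr rfl fun f _ => ?_
  simp only [ite_mul, one_mul, zero_mul]
  rfl

theorem ZMod.natCast_ne_zero_of_mem_Ioo {p i : ℕ} (hi : i ∈ Finset.Ioo 0 p) :
    (i : ZMod p) ≠ 0 := by
  rw [Finset.mem_Ioo] at hi
  rw [Ne, ZMod.natCast_eq_zero_iff]
  exact fun h => absurd (Nat.le_of_dvd hi.1 h) (by omega)

open Polynomial in
theorem coeff_prod_one_add_eq_nestedHarmonicSum {p : ℕ} (d k m : ℕ) (hk : k + d + 1 = p) :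
    (∏ j ∈ Finset.Ioo k p, (1 + C ((j : ZMod p)⁻¹) * X)).coeff m = nestedHarmonicSum p m k := by
  induction d generalizing k m with
  | zero =>
    have h : Finset.Ioo k p = ∅ := by ext; simp; omega
    cases m <;> simp [h, nestedHarmonicSum, coeff_one]
  | succ d ih =>
    have h : Finset.Ioo k p = insert (k + 1) (Finset.Ioo (k + 1) p) := by
      ext; simp; omega
    rw [h, Finset.prod_insert (by simp), add_mul, one_mul, coeff_add, mul_assoc, coeff_C_mul]
    cases m with
    | zero => simp [ih _ _ (show k + 1 + d + 1 = p by omega), nestedHarmonicSum]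
    | succ m =>
      rw [coeff_X_mul, ih _ _ (by omega), ih _ _ (by omega)]
      simp only [nestedHarmonicSum]
      rw [h, Finset.sum_insert (by simp), add_comm]

open Polynomial in
theorem prod_one_add_inv_mul_X (p : ℕ) [Fact p.Prime] :
    ∏ j ∈ Finset.Ioo 0 p, (1 + C ((j : ZMod p)⁻¹) * X) = 1 - X ^ (p - 1) := by
  have hp : p.Prime := Fact.out
  have hp2 := hp.two_le
  refine eq_of_degrees_lt_of_eval_finset_eq (Finset.univ : Finset (ZMod p)) ?_ ?_ ?_
  · refine lt_of_le_of_lt (degree_le_of_natDegree_le (n := p - 1) ?_) ?_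
    · refine (natDegree_prod_le _ _).trans ((Finset.sum_le_card_nsmul _ _ 1 fun j _ => ?_).trans ?_)
      · compute_degree
      · simp
    · simp only [Finset.card_univ, ZMod.card, Nat.cast_lt]
      omega
  · refine lt_of_le_of_lt (degree_le_of_natDegree_le (n := p - 1) ?_) ?_
    · compute_degree
    · simp only [Finset.card_univ, ZMod.card, Nat.cast_lt]
      omega
  · intro x _
    rw [eval_prod]
    by_cases hx : x = 0
    · simp [hx, show p - 1 ≠ 0 by omega]
    · have hv : (-x).val ∈ Finset.Ioo 0 p := by
        rw [Finset.mem_Ioo]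
        exact ⟨ZMod.val_pos.2 (neg_ne_zero.2 hx), ZMod.val_lt _⟩
      rw [Finset.prod_eq_zero hv]
      · simp [ZMod.pow_card_sub_one_eq_one hx]
      · simp only [ZMod.natCast_val, ZMod.cast_id', id_eq, eval_add, eval_one, eval_mul, eval_C,
          eval_X]
        field_simp
        ring

theorem nestedHarmonicSum_zero_eq_zero {p m : ℕ} [Fact p.Prime] (hm : 0 < m) (hmp : m + 1 < p) :
    nestedHarmonicSum p m 0 = 0 := by
  rw [← coeff_prod_one_add_eq_nestedHarmonicSum (p - 1) 0 m (by omega), prod_one_add_inv_mul_X]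
  simp [Polynomial.coeff_one, Polynomial.coeff_X_pow, hm.ne', show m ≠ p - 1 by omega]

open Polynomial in
/-- The truncated multiple polylogarithm `∑ x^{i₁}/(i₁⋯iₘ₊₁)` over `0 < i₁ < ⋯ < iₘ₊₁ < p`. -/
noncomputable def truncatedPolylog (p m : ℕ) : (ZMod p)[X] :=
  ∑ i ∈ Finset.Ioo 0 p, C ((i : ZMod p)⁻¹ * nestedHarmonicSum p m i) * X ^ i

open Polynomial in
theorem X_sub_one_mul_sum_Ioo {R : Type*} [CommRing R] {j : ℕ} (hj : 0 < j) :
    (X - 1 : R[X]) * ∑ i ∈ Finset.Ioo 0 j, X ^ i = X ^ j - X := by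
  have h := mul_geom_sum (X : R[X]) j
  rw [Finset.range_eq_Ico, ← Finset.Ioo_insert_left hj, Finset.sum_insert (by simp)] at h
  linear_combination h

open Polynomial in
theorem natDegree_truncatedPolylog_lt (p m : ℕ) (hp : 0 < p) :
    (truncatedPolylog p m).natDegree < p := by
  refine Nat.lt_of_le_pred hp (natDegree_sum_le_of_forall_le _ _ fun i hi => ?_)
  rw [Finset.mem_Ioo] at hi
  exact (natDegree_C_mul_X_pow_le _ _).trans (Nat.le_pred_of_lt hi.2)

open Polynomial in
theorem X_mul_derivative_truncatedPolylog (p m : ℕ) [Fact p.Prime] :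
    X * derivative (truncatedPolylog p m) =
      ∑ i ∈ Finset.Ioo 0 p, C (nestedHarmonicSum p m i) * X ^ i := by
  rw [truncatedPolylog, derivative_sum, Finset.mul_sum]
  refine Finset.sum_congr rfl fun i hi => ?_
  have hi0 := ZMod.natCast_ne_zero_of_mem_Ioo hi
  obtain ⟨k, rfl⟩ : ∃ k, i = k + 1 := ⟨i - 1, by rw [Finset.mem_Ioo] at hi; omega⟩
  have hC : C (((k + 1 : ℕ) : ZMod p)⁻¹ * nestedHarmonicSum p m (k + 1)) *
      C ((k + 1 : ℕ) : ZMod p) = C (nestedHarmonicSum p m (k + 1)) := by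
    rw [← C_mul]
    congr 1
    field_simp
  rw [derivative_C_mul_X_pow, C_mul, Nat.add_sub_cancel, ← hC]
  simp only [C_mul]
  ring

open Polynomial in
theorem derivative_truncatedPolylog_zero (p : ℕ) [Fact p.Prime] :
    X * (X - 1) * derivative (truncatedPolylog p 0) = X ^ p - X := by
  rw [mul_right_comm, X_mul_derivative_truncatedPolylog, mul_comm]
  simpa [nestedHarmonicSum] using
    X_sub_one_mul_sum_Ioo (R := ZMod p) (Fact.out : p.Prime).pos

open Polynomial in
theorem derivative_truncatedPolylog_succ (p m : ℕ) [Fact p.Prime] :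
    X * (X - 1) * derivative (truncatedPolylog p (m + 1)) =
      truncatedPolylog p m - C (nestedHarmonicSum p (m + 1) 0) * X := by
  rw [mul_right_comm, X_mul_derivative_truncatedPolylog, mul_comm]
  simp only [nestedHarmonicSum, truncatedPolylog, map_sum, Finset.sum_mul]
  rw [Finset.sum_comm' (t' := Finset.Ioo 0 p) (s' := fun j => Finset.Ioo 0 j)
    (by intro i j; simp only [Finset.mem_Ioo]; omega), Finset.mul_sum, ← Finset.sum_sub_distrib]
  refine Finset.sum_congr rfl fun j hj => ?_
  rw [← Finset.mul_sum, mul_left_comm, X_sub_one_mul_sum_Ioo (Finset.mem_Ioo.1 hj).1, mul_sub]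

open Polynomial in
/-- The reflection formula `L(1 - x) = ± L(x)` for truncated multiple polylogarithms mod `p`. -/
theorem truncatedPolylog_comp_one_sub_X (p m : ℕ) [Fact p.Prime] (hm : m + 2 < p) :
    (truncatedPolylog p m).comp (1 - X) = C ((-1) ^ m) * truncatedPolylog p m := by
  have hp : p.Prime := Fact.out
  have h0 (m : ℕ) : (truncatedPolylog p m).eval 0 = 0 := by
    rw [truncatedPolylog, eval_finsetSum]
    refine Finset.sum_eq_zero fun i hi => ?_
    simp [(Finset.mem_Ioo.1 hi).1.ne']
  have h1 (m : ℕ) (hm : m + 2 < p) : (truncatedPolylog p m).eval 1 = 0 := by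
    rw [← nestedHarmonicSum_zero_eq_zero (Nat.succ_pos m) hm, truncatedPolylog, eval_finsetSum]
    simp [nestedHarmonicSum]
  induction m with
  | zero =>
    refine comp_one_sub_X_of_derivative (natDegree_truncatedPolylog_lt p 0 hp.pos) (h0 0) (h1 0 hm)
      (derivative_truncatedPolylog_zero p) ?_
    have h := sub_pow_char (p := p) (1 : (ZMod p)[X]) X
    simp only [sub_comp, pow_comp, X_comp, h, pow_zero, map_one, one_pow]
    ring
  | succ m ih =>
    refine comp_one_sub_X_of_derivative (natDegree_truncatedPolylog_lt p _ hp.pos) (h0 _) (h1 _ hm)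
      (derivative_truncatedPolylog_succ p m) ?_
    rw [nestedHarmonicSum_zero_eq_zero (Nat.succ_pos m) (by omega), C_0, zero_mul, sub_zero,
      ih (by omega)]
    simp [pow_succ]

/-- If `ζ² - ζ + 1 = 0`, then `ζ^i + (1 - ζ)^i` depends only on `i` modulo `6`. -/
theorem pow_add_one_sub_pow_eq {R : Type*} [CommRing R] {ζ : R} (hζ : ζ ^ 2 - ζ + 1 = 0) (i : ℕ) :
    ζ ^ i + (1 - ζ) ^ i =
      2 * (if i % 6 = 0 then 1 else 0) + (if i % 6 = 1 then 1 else 0)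
        - (if i % 6 = 2 then 1 else 0) - 2 * (if i % 6 = 3 then 1 else 0)
        - (if i % 6 = 4 then 1 else 0) + (if i % 6 = 5 then 1 else 0) := by
  have h3 : ζ ^ 3 = -1 := by linear_combination (ζ + 1) * hζ
  have h3' : (1 - ζ) ^ 3 = -1 := by linear_combination (2 - ζ) * hζ
  have h6 : ζ ^ 6 = 1 := by linear_combination (ζ ^ 3 - 1) * h3
  have h6' : (1 - ζ) ^ 6 = 1 := by linear_combination ((1 - ζ) ^ 3 - 1) * h3'
  rw [pow_eq_pow_mod i h6, pow_eq_pow_mod i h6']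
  have hi : i % 6 < 6 := Nat.mod_lt _ (by norm_num)
  generalize i % 6 = r at hi ⊢
  interval_cases r <;> norm_num
  · linear_combination 2 * hζ
  · linear_combination h3 + h3'
  · linear_combination ζ * h3 + (1 - ζ) * h3'
  · linear_combination ζ ^ 2 * h3 + (1 - ζ) ^ 2 * h3' - 2 * hζ

/-- Let `n` be a positive even integer and `p > n + 1` a prime. Then
`2·S₀ + S₁ - S₂ - 2·S₃ - S₄ + S₅ = 0` in `ℤ/pℤ`. -/
theorem zhaoSunS_relation (n p : ℕ) (hn : 0 < n) (heven : Even n)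
    (hp : p.Prime) (hnp : n + 1 < p) :
    2 * zhaoSunS n p hn 0 + zhaoSunS n p hn 1 - zhaoSunS n p hn 2 -
      2 * zhaoSunS n p hn 3 - zhaoSunS n p hn 4 + zhaoSunS n p hn 5 = 0 := by
  have : Fact p.Prime := ⟨hp⟩
  obtain ⟨m, rfl⟩ : ∃ m, n = m + 1 := ⟨n - 1, by omega⟩
  have hodd : Odd m := by
    rw [Nat.even_add_one] at heven
    exact Nat.not_even_iff_odd.1 heven
  obtain ⟨ζ, hζ⟩ : ∃ ζ : AlgebraicClosure (ZMod p), ζ ^ 2 - ζ + 1 = 0 := by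
    have hdeg : (Polynomial.X ^ 2 - Polynomial.X + 1 :
        Polynomial (AlgebraicClosure (ZMod p))).degree = 2 := by
      compute_degree!
    obtain ⟨ζ, hζ⟩ := IsAlgClosed.exists_root _ (by rw [hdeg]; decide)
    exact ⟨ζ, by simpa [Polynomial.IsRoot] using hζ⟩
  have hrefl := congrArg (Polynomial.aeval ζ) (truncatedPolylog_comp_one_sub_X p m hnp)
  rw [hodd.neg_one_pow, Polynomial.aeval_comp] at hrefl
  apply FaithfulSMul.algebraMap_injective (ZMod p) (AlgebraicClosure (ZMod p))
  simp only [zhaoSunS_eq_sum, Finset.mul_sum, ← Finset.sum_add_distrib, ← Finset.sum_sub_distrib,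
    map_sum, map_zero]
  trans Polynomial.aeval ζ (truncatedPolylog p m) + Polynomial.aeval (1 - ζ) (truncatedPolylog p m)
  · simp only [truncatedPolylog, map_sum, ← Finset.sum_add_distrib]
    refine Finset.sum_congr rfl fun i _ => ?_
    simp only [map_mul, map_pow, Polynomial.aeval_C, Polynomial.aeval_X, ← mul_add,
      pow_add_one_sub_pow_eq hζ i]
    simp only [map_add, map_sub, map_mul, apply_ite (algebraMap (ZMod p) _), map_one, map_zero,
      map_ofNat]
    ring
  · simp only [map_sub, map_one, Polynomial.aeval_X, map_neg, neg_mul, one_mul] at hrefl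
    rw [hrefl, add_neg_cancel]
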